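/- arXiv:2002.00007 — 10 statements merged into one kernel-verified Lean document; each statement's English description precedes it below -/
import Mathlib

section
/- The map Ω restricted to B^{6,∞} is a bijection from B^{6,∞} onto ℤ^{15}; its inverse sends x = (x_6^{(3)},x_4^{(4)},x_3^{(3)},x_2^{(2)},x_5^{(2)},x_4^{(3)},x_3^{(2)},x_6^{(2)},x_4^{(2)},x_5^{(1)},x_1^{(1)},x_2^{(1)},x_3^{(1)},x_4^{(1)},x_6^{(1)}) ∈ ℤ^{15} to the array b with b_{11}=x_1^{(1)}, b_{12}=x_2^{(2)}−x_1^{(1)}, b_{13}=x_3^{(3)}−x_2^{(2)}, b_{14}=x_4^{(4)}−x_3^{(3)}, b_{15}=x_6^{(3)}−x_4^{(4)}, b_{16}=−x_6^{(3)}, b_{22}=x_2^{(1)}, b_{23}=x_3^{(2)}−x_2^{(1)}, b_{24}=x_4^{(3)}−x_3^{(2)}, b_{25}=x_5^{(2)}−x_4^{(3)}, b_{26}=x_6^{(3)}−x_5^{(2)}, b_{27}=−x_6^{(3)}, b_{33}=x_3^{(1)}, b_{34}=x_4^{(2)}−x_3^{(1)}, b_{35}=x_6^{(2)}−x_4^{(2)},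 b_{36}=x_5^{(2)}−x_6^{(2)}, b_{37}=x_4^{(4)}−x_5^{(2)}, b_{38}=−x_4^{(4)}, b_{44}=x_4^{(1)}, b_{45}=x_5^{(1)}−x_4^{(1)}, b_{46}=x_6^{(2)}−x_5^{(1)}, b_{47}=x_4^{(3)}−x_6^{(2)}, b_{48}=x_3^{(3)}−x_4^{(3)}, b_{49}=−x_3^{(3)}, b_{55}=x_6^{(1)}, b_{56}=x_5^{(1)}−x_6^{(1)}, b_{57}=x_4^{(2)}−x_5^{(1)}, b_{58}=x_3^{(2)}−x_4^{(2)}, b_{59}=x_2^{(2)}−x_3^{(2)}, b_{5,10}=−x_2^{(2)}, b_{66}=x_6^{(1)}, b_{67}=x_4^{(1)}−x_6^{(1)}, b_{68}=x_3^{(1)}−x_4^{(1)}, b_{69}=x_2^{(1)}−x_3^{(1)}, b_{6,10}=x_1^{(1)}−x_2^{(1)}, b_{6,11}=−x_1^{(1)}; this array lies in B^{6,∞}. -/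
namespace D6spin

abbrev Arr := Fin 6 → Fin 6 → ℤ

def Binf (b : Arr) : Prop :=
  (b 0 0 + b 0 1 + b 0 2 + b 0 3 + b 0 4 + b 0 5 = 0) ∧
  (b 1 0 + b 1 1 + b 1 2 + b 1 3 + b 1 4 + b 1 5 = 0) ∧
  (b 2 0 + b 2 1 + b 2 2 + b 2 3 + b 2 4 + b 2 5 = 0) ∧
  (b 3 0 + b 3 1 + b 3 2 + b 3 3 + b 3 4 + b 3 5 = 0) ∧
  (b 4 0 + b 4 1 + b 4 2 + b 4 3 + b 4 4 + b 4 5 = 0) ∧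
  (b 5 0 + b 5 1 + b 5 2 + b 5 3 + b 5 4 + b 5 5 = 0) ∧
  (b 0 0 + b 0 1 + b 0 2 + b 0 3 + b 0 4 = b 1 0 + b 1 1 + b 1 2 + b 1 3 + b 1 4) ∧
  (b 0 0 + b 0 1 + b 0 2 + b 0 3 = b 2 0 + b 2 1 + b 2 2 + b 2 3 + b 2 4) ∧
  (b 0 0 + b 0 1 + b 0 2 = b 3 0 + b 3 1 + b 3 2 + b 3 3 + b 3 4) ∧
  (b 0 0 + b 0 1 = b 4 0 + b 4 1 + b 4 2 + b 4 3 + b 4 4) ∧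
  (b 0 0 = b 5 0 + b 5 1 + b 5 2 + b 5 3 + b 5 4) ∧
  (b 1 0 + b 1 1 + b 1 2 + b 1 3 = b 2 0 + b 2 1 + b 2 2 + b 2 3) ∧
  (b 1 0 + b 1 1 + b 1 2 = b 3 0 + b 3 1 + b 3 2 + b 3 3) ∧
  (b 1 0 + b 1 1 = b 4 0 + b 4 1 + b 4 2 + b 4 3) ∧
  (b 1 0 = b 5 0 + b 5 1 + b 5 2 + b 5 3) ∧
  (b 2 0 + b 2 1 + b 2 2 = b 3 0 + b 3 1 + b 3 2) ∧
  (b 2 0 + b 2 1 = b 4 0 + b 4 1 + b 4 2) ∧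
  (b 2 0 = b 5 0 + b 5 1 + b 5 2) ∧
  (b 3 0 + b 3 1 = b 4 0 + b 4 1) ∧
  (b 3 0 = b 5 0 + b 5 1) ∧
  (b 4 0 = b 5 0)

def Omega (b : Arr) : Fin 15 → ℤ :=
  ![b 0 0 + b 0 1 + b 0 2 + b 0 3 + b 0 4,
    b 0 0 + b 0 1 + b 0 2 + b 0 3,
    b 0 0 + b 0 1 + b 0 2,
    b 0 0 + b 0 1,
    b 1 0 + b 1 1 + b 1 2 + b 1 3,
    b 1 0 + b 1 1 + b 1 2,
    b 1 0 + b 1 1,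
    b 2 0 + b 2 1 + b 2 2,
    b 2 0 + b 2 1,
    b 3 0 + b 3 1,
    b 0 0,
    b 1 0,
    b 2 0,
    b 3 0,
    b 4 0]

def Psi (x : Fin 15 → ℤ) : Arr :=
  ![![x 10, x 3 - x 10, x 2 - x 3, x 1 - x 2, x 0 - x 1, -x 0],
    ![x 11, x 6 - x 11, x 5 - x 6, x 4 - x 5, x 0 - x 4, -x 0],
    ![x 12, x 8 - x 12, x 7 - x 8, x 4 - x 7, x 1 - x 4, -x 1],
    ![x 13, x 9 - x 13, x 7 - x 9, x 5 - x 7, x 2 - x 5, -x 2],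
    ![x 14, x 9 - x 14, x 8 - x 9, x 6 - x 8, x 3 - x 6, -x 3],
    ![x 14, x 13 - x 14, x 12 - x 13, x 11 - x 12, x 10 - x 11, -x 10]]

lemma binf_Psi (x : Fin 15 → ℤ) : Binf (Psi x) := by
  simp [Binf, Psi]

lemma Omega_Psi (x : Fin 15 → ℤ) : Omega (Psi x) = x := by
  ext i
  fin_cases i <;> simp [Omega, Psi]

lemma Psi_Omega {b : Arr} (hb : Binf b) : Psi (Omega b) = b := by
  unfold Binf at hb
  ext i j
  fin_cases i <;> fin_cases j <;> simp [Omega, Psi] <;> lia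

theorem statement0 :
    (∀ x : Fin 15 → ℤ, Binf (Psi x) ∧ Omega (Psi x) = x) ∧
    (∀ b : Arr, Binf b → Psi (Omega b) = b) ∧
    Function.Bijective (fun b : {b : Arr // Binf b} => Omega b.1) := by
  refine ⟨fun x => ⟨binf_Psi x, Omega_Psi x⟩, fun b hb => Psi_Omega hb, ?_⟩
  exact Function.bijective_iff_has_inverse.mpr
    ⟨fun x => ⟨Psi x, binf_Psi x⟩, fun b => Subtype.ext (Psi_Omega b.2), Omega_Psi⟩

end D6spin
end

section
/- Let l ≥ 1 and b ∈ B^{6,l}. Then ε_0(b) + ε_1(b) + 2ε_2(b) + 2ε_3(b) + 2ε_4(b) + ε_5(b) + ε_6(b) = l if and only if there exist nonnegative integers a_0,…,a_6 with a_0+a_1+2a_2+2a_3+2a_4+a_5+a_6 = l and b = b^0(a). -/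
namespace D6spin

def B6l (l : ℤ) (b : Arr) : Prop :=
  (∀ i j, 0 ≤ b i j) ∧
  (b 0 0 + b 0 1 + b 0 2 + b 0 3 + b 0 4 + b 0 5 = l) ∧
  (b 1 0 + b 1 1 + b 1 2 + b 1 3 + b 1 4 + b 1 5 = l) ∧
  (b 2 0 + b 2 1 + b 2 2 + b 2 3 + b 2 4 + b 2 5 = l) ∧
  (b 3 0 + b 3 1 + b 3 2 + b 3 3 + b 3 4 + b 3 5 = l) ∧
  (b 4 0 + b 4 1 + b 4 2 + b 4 3 + b 4 4 + b 4 5 = l) ∧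
  (b 5 0 + b 5 1 + b 5 2 + b 5 3 + b 5 4 + b 5 5 = l) ∧
  (b 0 0 + b 0 1 + b 0 2 + b 0 3 + b 0 4 = b 1 0 + b 1 1 + b 1 2 + b 1 3 + b 1 4) ∧
  (b 0 0 + b 0 1 + b 0 2 + b 0 3 = b 2 0 + b 2 1 + b 2 2 + b 2 3 + b 2 4) ∧
  (b 0 0 + b 0 1 + b 0 2 = b 3 0 + b 3 1 + b 3 2 + b 3 3 + b 3 4) ∧
  (b 0 0 + b 0 1 = b 4 0 + b 4 1 + b 4 2 + b 4 3 + b 4 4) ∧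
  (b 0 0 = b 5 0 + b 5 1 + b 5 2 + b 5 3 + b 5 4) ∧
  (b 1 0 + b 1 1 + b 1 2 + b 1 3 = b 2 0 + b 2 1 + b 2 2 + b 2 3) ∧
  (b 1 0 + b 1 1 + b 1 2 = b 3 0 + b 3 1 + b 3 2 + b 3 3) ∧
  (b 1 0 + b 1 1 = b 4 0 + b 4 1 + b 4 2 + b 4 3) ∧
  (b 1 0 = b 5 0 + b 5 1 + b 5 2 + b 5 3) ∧
  (b 2 0 + b 2 1 + b 2 2 = b 3 0 + b 3 1 + b 3 2) ∧
  (b 2 0 + b 2 1 = b 4 0 + b 4 1 + b 4 2) ∧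
  (b 2 0 = b 5 0 + b 5 1 + b 5 2) ∧
  (b 3 0 + b 3 1 = b 4 0 + b 4 1) ∧
  (b 3 0 = b 5 0 + b 5 1) ∧
  (b 4 0 = b 5 0) ∧
  (b 0 0 ≥ b 1 0) ∧
  (b 0 0 + b 0 1 ≥ b 1 0 + b 1 1) ∧
  (b 0 0 + b 0 1 + b 0 2 ≥ b 1 0 + b 1 1 + b 1 2) ∧
  (b 0 0 + b 0 1 + b 0 2 + b 0 3 ≥ b 1 0 + b 1 1 + b 1 2 + b 1 3) ∧
  (b 0 0 + b 0 1 + b 0 2 + b 0 3 + b 0 4 ≥ b 1 0 + b 1 1 + b 1 2 + b 1 3 + b 1 4) ∧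
  (b 1 0 ≥ b 2 0) ∧
  (b 1 0 + b 1 1 ≥ b 2 0 + b 2 1) ∧
  (b 1 0 + b 1 1 + b 1 2 ≥ b 2 0 + b 2 1 + b 2 2) ∧
  (b 1 0 + b 1 1 + b 1 2 + b 1 3 ≥ b 2 0 + b 2 1 + b 2 2 + b 2 3) ∧
  (b 2 0 ≥ b 3 0) ∧
  (b 2 0 + b 2 1 ≥ b 3 0 + b 3 1) ∧
  (b 2 0 + b 2 1 + b 2 2 ≥ b 3 0 + b 3 1 + b 3 2) ∧
  (b 3 0 ≥ b 4 0) ∧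
  (b 3 0 + b 3 1 ≥ b 4 0 + b 4 1) ∧
  (b 4 0 ≥ b 5 0)

def b0arr (a0 a1 a2 a3 a4 a5 a6 : ℤ) : Arr :=
  ![![a1 + a2 + a3 + a4 + a6, a5, a4, a3, a2, a0],
    ![a2 + a3 + a4 + a6, a5, a4, a3, a1 + a2, a0],
    ![a3 + a4 + a6, a5, a4, a2 + a3, a1, a0 + a2],
    ![a4 + a6, a5, a3 + a4, a2, a1, a0 + a2 + a3],
    ![a6, a4 + a5, a3, a2, a1, a0 + a2 + a3 + a4],
    ![a6, a4, a3, a2, a1, a0 + a2 + a3 + a4 + a5]]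

def A1 (b : Arr) : ℤ :=
  max (-b 4 1 - b 4 2 - b 4 3 - b 4 4 - b 4 5) (max (-b 0 2 - b 1 1 - b 3 2 - b 3 3 - b 3 4 - b 3 5) (max (-b 0 2 - b 2 1 - b 3 2 - b 3 3 - b 3 4 - b 3 5) (max (-b 0 2 - b 3 1 - b 3 2 - b 3 3 - b 3 4 - b 3 5) (max (-b 1 2 - b 2 1 - b 3 2 - b 3 3 - b 3 4 - b 3 5) (max (-b 1 2 - b 3 1 - b 3 2 - b 3 3 - b 3 4 - b 3 5) (max (-b 2 2 - b 3 1 - b 3 2 - b 3 3 - b 3 4 - b 3 5) (max (-b 0 2 - b 0 3 - b 0 4 - b 1 1 - b 1 2 - b 1 3 - b 1 4 - b 1 5) (max (-b 0 2 - b 0 3 - b 1 1 - b 1 2 - b 2 3 - b 2 4 - b 2 5) (max (-b 0 2 - b 0 3 - b 1 1 - b 2 2 - b 2 3 - b 2 4 - b 2 5) (max (-b 0 2 - b 1 1 - b 1 3 - b 2 2 - b 2 3 - b 2 4 - b 2 5) (max (-b 0 2 - b 0 3 - b 2 1 - b 2 2 - b 2 3 - b 2 4 - b 2 5) (max (-b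 0 2 - b 1 3 - b 2 1 - b 2 2 - b 2 3 - b 2 4 - b 2 5) (-b 1 2 - b 1 3 - b 2 1 - b 2 2 - b 2 3 - b 2 4 - b 2 5)))))))))))))

def A2 (b : Arr) : ℤ :=
  max (-b 0 0 - b 0 1 - b 0 2 - b 0 3 - b 0 4) (max (-b 0 0 - b 0 1 - b 0 2 - b 0 3 - 2 * b 0 4 + b 1 0 + b 1 1 + b 1 2 - b 2 0 - b 2 1 - b 2 2) (-b 0 0 - b 0 1 - b 0 2 - b 0 3 - 2 * b 0 4 + b 1 0 + b 1 1 + b 1 2 - b 2 0 - b 2 1 - 2 * b 2 2 + b 3 0 - b 4 0))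

def eps1 (b : Arr) : ℤ := b 0 1
def eps2 (b : Arr) : ℤ := max (b 0 2) (-b 0 1 + b 0 2 + b 1 1)
def eps3 (b : Arr) : ℤ :=
  max (b 0 3) (max (-b 0 2 + b 0 3 + b 1 2) (-b 0 2 + b 0 3 - b 1 1 + b 1 2 + b 2 1))
def eps4 (b : Arr) : ℤ :=
  max (b 0 4) (max (-b 0 3 + b 0 4 + b 1 3)
    (max (-b 0 3 + b 0 4 - b 1 2 + b 1 3 + b 2 2)
      (-b 0 3 + b 0 4 - b 1 2 + b 1 3 - b 2 1 + b 2 2 + b 3 1)))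
def eps5 (b : Arr) : ℤ :=
  max (b 0 0 + b 0 1 + b 0 2 + b 0 3 - b 1 0 - b 1 1 - b 1 2 - b 1 3)
    (b 0 0 + b 0 1 + b 0 2 + b 0 3 - b 1 0 - b 1 1 - b 1 2 - 2 * b 1 3 + b 2 0 + b 2 1 - b 3 0 - b 3 1)

theorem entries_of_eps_sum_eq {l : ℤ} {b : Arr} (hb : B6l l b)
    (h : (l + A1 b) + eps1 b + 2 * eps2 b + 2 * eps3 b + 2 * eps4 b + eps5 b + (l + A2 b) = l) :
    b 1 1 = b 0 1 ∧ b 1 2 = b 0 2 ∧ b 1 3 = b 0 3 ∧ b 2 1 = b 0 1 ∧ b 2 2 = b 0 2 ∧ b 3 1 = b 0 1 ∧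
      b 1 0 = b 0 4 + b 2 0 ∧ b 2 0 = b 0 3 + b 3 0 ∧ b 3 0 = b 0 2 + b 4 0 ∧ b 0 4 ≤ b 1 4 := by
  obtain ⟨-, hr0, hr1, hr2, hr3, hr4, hr5, h01, h02, h03, h04, h05, h12, h13, h14, h15,
    h23, h24, h25, h34, h35, h45, g00, g01, g02, g03, g04, g10, g11, g12, g13, g20, g21, g22,
    g30, g31, g40⟩ := hb
  have hA1 := le_refl (A1 b)
  have hA2 := le_refl (A2 b)
  have he2 := le_refl (eps2 b)
  have he3 := le_refl (eps3 b)
  have he4 := le_refl (eps4 b)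
  have he5 := le_refl (eps5 b)
  conv_lhs at hA1 => unfold A1
  conv_lhs at hA2 => unfold A2
  conv_lhs at he2 => unfold eps2
  conv_lhs at he3 => unfold eps3
  conv_lhs at he4 => unfold eps4
  conv_lhs at he5 => unfold eps5
  simp only [max_le_iff] at hA1 hA2 he2 he3 he4 he5
  obtain ⟨p0, p1, p2, p3, p4, p5, p6, p7, p8, p9, p10, p11, p12, p13⟩ := hA1
  obtain ⟨q0, q1, q2⟩ := hA2
  obtain ⟨s0, s1⟩ := he2
  obtain ⟨t0, t1, t2⟩ := he3
  obtain ⟨u0, u1, u2, u3⟩ := he4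
  obtain ⟨v0, v1⟩ := he5
  unfold eps1 at h
  refine ⟨?_, ?_, ?_, ?_, ?_, ?_, ?_, ?_, ?_, ?_⟩ <;> linarith

theorem eq_b0arr_of_entries {l : ℤ} {b : Arr} (hb : B6l l b)
    (h : b 1 1 = b 0 1 ∧ b 1 2 = b 0 2 ∧ b 1 3 = b 0 3 ∧ b 2 1 = b 0 1 ∧ b 2 2 = b 0 2 ∧ b 3 1 = b 0 1 ∧
      b 1 0 = b 0 4 + b 2 0 ∧ b 2 0 = b 0 3 + b 3 0 ∧ b 3 0 = b 0 2 + b 4 0) :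
    b = b0arr (b 0 5) (b 1 4 - b 0 4) (b 0 4) (b 0 3) (b 0 2) (b 0 1) (b 4 0) := by
  obtain ⟨-, hr0, hr1, hr2, hr3, hr4, hr5, h01, h02, h03, h04, h05, h12, h13, h14, h15,
    h23, h24, h25, h34, h35, h45, -⟩ := hb
  obtain ⟨e11, e12, e13, e21, e22, e31, e10, e20, e30⟩ := h
  funext i j
  fin_cases i <;> fin_cases j <;> simp [b0arr] <;> lia

theorem A1_b0arr (a0 a1 a2 a3 a4 a5 a6 : ℤ) :
    A1 (b0arr a0 a1 a2 a3 a4 a5 a6) = -(a0 + a1 + 2 * a2 + 2 * a3 + 2 * a4 + a5) := by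
  apply le_antisymm
  · simp only [A1, max_le_iff]
    refine ⟨?_, ?_, ?_, ?_, ?_, ?_, ?_, ?_, ?_, ?_, ?_, ?_, ?_, ?_⟩ <;> simp [b0arr] <;> linarith
  · refine le_max_of_le_left ?_
    simp [b0arr]
    linarith

theorem A2_b0arr (a0 a1 a2 a3 a4 a5 a6 : ℤ) :
    A2 (b0arr a0 a1 a2 a3 a4 a5 a6) = -(a1 + 2 * a2 + 2 * a3 + 2 * a4 + a5 + a6) := by
  apply le_antisymm
  · simp only [A2, max_le_iff]
    refine ⟨?_, ?_, ?_⟩ <;> simp [b0arr] <;> linarith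
  · refine le_max_of_le_left ?_
    simp [b0arr]
    linarith

theorem eps_sum_b0arr (a0 a1 a2 a3 a4 a5 a6 : ℤ) :
    eps1 (b0arr a0 a1 a2 a3 a4 a5 a6) + 2 * eps2 (b0arr a0 a1 a2 a3 a4 a5 a6)
      + 2 * eps3 (b0arr a0 a1 a2 a3 a4 a5 a6) + 2 * eps4 (b0arr a0 a1 a2 a3 a4 a5 a6)
      + eps5 (b0arr a0 a1 a2 a3 a4 a5 a6) = a5 + 2 * a4 + 2 * a3 + 2 * a2 + a1 := by
  simp [b0arr, eps1, eps2, eps3, eps4, eps5]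
  omega

theorem statement4 (l : ℤ) (hl : 1 ≤ l) (b : Arr) (hb : B6l l b) :
    (l + A1 b) + eps1 b + 2 * eps2 b + 2 * eps3 b + 2 * eps4 b + eps5 b + (l + A2 b) = l ↔
      ∃ a0 a1 a2 a3 a4 a5 a6 : ℤ,
        0 ≤ a0 ∧ 0 ≤ a1 ∧ 0 ≤ a2 ∧ 0 ≤ a3 ∧ 0 ≤ a4 ∧ 0 ≤ a5 ∧ 0 ≤ a6 ∧
        a0 + a1 + 2 * a2 + 2 * a3 + 2 * a4 + a5 + a6 = l ∧
        b = b0arr a0 a1 a2 a3 a4 a5 a6 := by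
  constructor
  · intro h
    obtain ⟨e11, e12, e13, e21, e22, e31, e10, e20, e30, e14⟩ := entries_of_eps_sum_eq hb h
    have hb0 := eq_b0arr_of_entries hb ⟨e11, e12, e13, e21, e22, e31, e10, e20, e30⟩
    have h00 := congrFun (congrFun hb0 0) 0
    simp [b0arr] at h00
    obtain ⟨h_nonneg, hr0, -⟩ := hb
    exact ⟨b 0 5, b 1 4 - b 0 4, b 0 4, b 0 3, b 0 2, b 0 1, b 4 0, h_nonneg _ _, by linarith,
      h_nonneg _ _, h_nonneg _ _, h_nonneg _ _, h_nonneg _ _, h_nonneg _ _, by linarith, hb0⟩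
  · rintro ⟨a0, a1, a2, a3, a4, a5, a6, -, -, -, -, -, -, -, hsum, rfl⟩
    have hA1 := A1_b0arr a0 a1 a2 a3 a4 a5 a6
    have hA2 := A2_b0arr a0 a1 a2 a3 a4 a5 a6
    have heps := eps_sum_b0arr a0 a1 a2 a3 a4 a5 a6
    linarith

end D6spin
end

section
/- Let b' ∈ B^{6,∞}. Define a_1 = max{−b'_{11}+b'_{22}, −b'_{11}−b'_{12}+b'_{22}+b'_{23}, −b'_{11}−b'_{12}−b'_{13}+b'_{22}+b'_{23}+b'_{24}, −b'_{11}−b'_{12}−b'_{13}−b'_{14}+b'_{22}+b'_{23}+b'_{24}+b'_{25}, 0}; a_2 = max{−b'_{22}+b'_{33}, −b'_{22}−b'_{23}+b'_{33}+b'_{34}, −b'_{22}−b'_{23}−b'_{24}+b'_{33}+b'_{34}+b'_{35}, −b'_{15}, −b'_{26}−a_1, 0}; a_3 = max{−b'_{33}+b'_{44}, −b'_{33}−b'_{34}+b'_{44}+b'_{45}, −b'_{14}, −b'_{25}, −b'_{36}−a_2, 0}; a_4 = max{−b'_{44}+b'_{55}, −b'_{13}, −b'_{24}, −b'_{35}, −b'_{46}−a_3,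 0}; a_5 = max{−b'_{12}, −b'_{23}, −b'_{34}, −b'_{45}, −b'_{56}−a_4, 0}; a_6 = max{−b'_{11}−a_1−a_2−a_3−a_4, −b'_{22}−a_2−a_3−a_4, −b'_{33}−a_3−a_4, −b'_{44}−a_4, −b'_{55}, 0}; a_0 = max{b'_{11}−a_2−a_3−a_4−a_5, b'_{11}+b'_{12}−a_2−a_3−a_4, b'_{11}+b'_{12}+b'_{13}−a_2−a_3, b'_{11}+b'_{12}+b'_{13}+b'_{14}−a_2, b'_{11}+b'_{12}+b'_{13}+b'_{14}+b'_{15}, 0}; and l = a_0+a_1+2a_2+2a_3+2a_4+a_5+a_6. Then the array b with b_{ij} = b'_{ij} + b^0(a)_{ij} belongs to B^{6,l}. -/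
namespace D6spin

set_option maxHeartbeats 2000000 in
theorem statement5 (b : Arr) (hb : Binf b) (a1 a2 a3 a4 a5 a6 a0 l : ℤ)
    (ha1 : a1 = max (-b 0 0 + b 1 0) (max (-b 0 0 - b 0 1 + b 1 0 + b 1 1) (max (-b 0 0 - b 0 1 - b 0 2 + b 1 0 + b 1 1 + b 1 2) (max (-b 0 0 - b 0 1 - b 0 2 - b 0 3 + b 1 0 + b 1 1 + b 1 2 + b 1 3) (0)))))
    (ha2 : a2 = max (-b 1 0 + b 2 0) (max (-b 1 0 - b 1 1 + b 2 0 + b 2 1) (max (-b 1 0 - b 1 1 - b 1 2 + b 2 0 + b 2 1 + b 2 2) (max (-b 0 4) (max (-b 1 4 - a1) (0))))))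
    (ha3 : a3 = max (-b 2 0 + b 3 0) (max (-b 2 0 - b 2 1 + b 3 0 + b 3 1) (max (-b 0 3) (max (-b 1 3) (max (-b 2 3 - a2) (0))))))
    (ha4 : a4 = max (-b 3 0 + b 4 0) (max (-b 0 2) (max (-b 1 2) (max (-b 2 2) (max (-b 3 2 - a3) (0))))))
    (ha5 : a5 = max (-b 0 1) (max (-b 1 1) (max (-b 2 1) (max (-b 3 1) (max (-b 4 1 - a4) (0))))))
    (ha6 : a6 = max (-b 0 0 - a1 - a2 - a3 - a4) (max (-b 1 0 - a2 - a3 - a4) (max (-b 2 0 - a3 - a4) (max (-b 3 0 - a4) (max (-b 4 0) (0))))))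
    (ha0 : a0 = max (b 0 0 - a2 - a3 - a4 - a5) (max (b 0 0 + b 0 1 - a2 - a3 - a4) (max (b 0 0 + b 0 1 + b 0 2 - a2 - a3) (max (b 0 0 + b 0 1 + b 0 2 + b 0 3 - a2) (max (b 0 0 + b 0 1 + b 0 2 + b 0 3 + b 0 4) (0))))))
    (hl : l = a0 + a1 + 2 * a2 + 2 * a3 + 2 * a4 + a5 + a6) :
    B6l l (b + b0arr a0 a1 a2 a3 a4 a5 a6) := by
  obtain ⟨h1_0, h1_1, h1_2, h1_3, h1_4⟩ := by
    simpa only [max_le_iff] using ha1.ge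
  obtain ⟨h2_0, h2_1, h2_2, h2_3, h2_4, h2_5⟩ := by
    simpa only [max_le_iff] using ha2.ge
  obtain ⟨h3_0, h3_1, h3_2, h3_3, h3_4, h3_5⟩ := by
    simpa only [max_le_iff] using ha3.ge
  obtain ⟨h4_0, h4_1, h4_2, h4_3, h4_4, h4_5⟩ := by
    simpa only [max_le_iff] using ha4.ge
  obtain ⟨h5_0, h5_1, h5_2, h5_3, h5_4, h5_5⟩ := by
    simpa only [max_le_iff] using ha5.ge
  obtain ⟨h6_0, h6_1, h6_2, h6_3, h6_4, h6_5⟩ := by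
    simpa only [max_le_iff] using ha6.ge
  obtain ⟨h0_0, h0_1, h0_2, h0_3, h0_4, h0_5⟩ := by
    simpa only [max_le_iff] using ha0.ge
  clear ha0 ha1 ha2 ha3 ha4 ha5 ha6
  obtain ⟨e1, e2, e3, e4, e5, e6, e7, e8, e9, e10, e11, e12, e13, e14, e15, e16, e17, e18,
    e19, e20, e21⟩ := hb
  subst hl
  refine ⟨?_, ?_⟩
  · simp only [Fin.forall_fin_succ, Fin.forall_fin_zero]
    simp [b0arr]
    refine ⟨⟨?_, ?_, ?_, ?_, ?_, ?_⟩, ⟨?_, ?_, ?_, ?_, ?_, ?_⟩, ⟨?_, ?_, ?_, ?_, ?_, ?_⟩,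
      ⟨?_, ?_, ?_, ?_, ?_, ?_⟩, ⟨?_, ?_, ?_, ?_, ?_, ?_⟩, ⟨?_, ?_, ?_, ?_, ?_, ?_⟩⟩ <;> linarith
  · simp [b0arr]
    and_intros <;> linarith

end D6spin
end

section
/- Let a_0,…,a_6 be nonnegative integers, b^0 = b^0(a), and let b be any integer array indexed by 1 ≤ i ≤ 6, i ≤ j ≤ i+5. Then for each k ∈ {1,2,3,4,5,6}: b and b − b^0 satisfy the same case conditions in the definitions of ẽ_k and f̃_k, and ẽ_k(b − b^0) = ẽ_k(b) − b^0 and f̃_k(b − b^0) = f̃_k(b) − b^0 (as arrays, with the operators applied by their explicit piecewise formulas). -/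
namespace D6spin

def dft1 : Arr :=
  ![![-1, 1, 0, 0, 0, 0],
    ![0, 0, 0, 0, 0, 0],
    ![0, 0, 0, 0, 0, 0],
    ![0, 0, 0, 0, 0, 0],
    ![0, 0, 0, 0, 0, 0],
    ![0, 0, 0, 0, -1, 1]]

def dft2a : Arr :=
  ![![0, -1, 1, 0, 0, 0],
    ![0, 0, 0, 0, 0, 0],
    ![0, 0, 0, 0, 0, 0],
    ![0, 0, 0, 0, 0, 0],
    ![0, 0, 0, 0, -1, 1],
    ![0, 0, 0, 0, 0, 0]]

def dft2b : Arr :=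
  ![![0, 0, 0, 0, 0, 0],
    ![-1, 1, 0, 0, 0, 0],
    ![0, 0, 0, 0, 0, 0],
    ![0, 0, 0, 0, 0, 0],
    ![0, 0, 0, 0, 0, 0],
    ![0, 0, 0, -1, 1, 0]]

def dft3a : Arr :=
  ![![0, 0, -1, 1, 0, 0],
    ![0, 0, 0, 0, 0, 0],
    ![0, 0, 0, 0, 0, 0],
    ![0, 0, 0, 0, -1, 1],
    ![0, 0, 0, 0, 0, 0],
    ![0, 0, 0, 0, 0, 0]]

def dft3b : Arr :=
  ![![0, 0, 0, 0, 0, 0],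
    ![0, -1, 1, 0, 0, 0],
    ![0, 0, 0, 0, 0, 0],
    ![0, 0, 0, 0, 0, 0],
    ![0, 0, 0, -1, 1, 0],
    ![0, 0, 0, 0, 0, 0]]

def dft3c : Arr :=
  ![![0, 0, 0, 0, 0, 0],
    ![0, 0, 0, 0, 0, 0],
    ![-1, 1, 0, 0, 0, 0],
    ![0, 0, 0, 0, 0, 0],
    ![0, 0, 0, 0, 0, 0],
    ![0, 0, -1, 1, 0, 0]]

def dft4a : Arr :=
  ![![0, 0, 0, -1, 1, 0],
    ![0, 0, 0, 0, 0, 0],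
    ![0, 0, 0, 0, -1, 1],
    ![0, 0, 0, 0, 0, 0],
    ![0, 0, 0, 0, 0, 0],
    ![0, 0, 0, 0, 0, 0]]

def dft4b : Arr :=
  ![![0, 0, 0, 0, 0, 0],
    ![0, 0, -1, 1, 0, 0],
    ![0, 0, 0, 0, 0, 0],
    ![0, 0, 0, -1, 1, 0],
    ![0, 0, 0, 0, 0, 0],
    ![0, 0, 0, 0, 0, 0]]

def dft4c : Arr :=
  ![![0, 0, 0, 0, 0, 0],
    ![0, 0, 0, 0, 0, 0],
    ![0, -1, 1, 0, 0, 0],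
    ![0, 0, 0, 0, 0, 0],
    ![0, 0, -1, 1, 0, 0],
    ![0, 0, 0, 0, 0, 0]]

def dft4d : Arr :=
  ![![0, 0, 0, 0, 0, 0],
    ![0, 0, 0, 0, 0, 0],
    ![0, 0, 0, 0, 0, 0],
    ![-1, 1, 0, 0, 0, 0],
    ![0, 0, 0, 0, 0, 0],
    ![0, -1, 1, 0, 0, 0]]

def dft5a : Arr :=
  ![![0, 0, 0, 0, 0, 0],
    ![0, 0, 0, -1, 1, 0],
    ![0, 0, 0, -1, 1, 0],
    ![0, 0, 0, 0, 0, 0],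
    ![0, 0, 0, 0, 0, 0],
    ![0, 0, 0, 0, 0, 0]]

def dft5b : Arr :=
  ![![0, 0, 0, 0, 0, 0],
    ![0, 0, 0, 0, 0, 0],
    ![0, 0, 0, 0, 0, 0],
    ![0, -1, 1, 0, 0, 0],
    ![0, -1, 1, 0, 0, 0],
    ![0, 0, 0, 0, 0, 0]]

def dft6a : Arr :=
  ![![0, 0, 0, 0, -1, 1],
    ![0, 0, 0, 0, -1, 1],
    ![0, 0, 0, 0, 0, 0],
    ![0, 0, 0, 0, 0, 0],
    ![0, 0, 0, 0, 0, 0],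
    ![0, 0, 0, 0, 0, 0]]

def dft6b : Arr :=
  ![![0, 0, 0, 0, 0, 0],
    ![0, 0, 0, 0, 0, 0],
    ![0, 0, -1, 1, 0, 0],
    ![0, 0, -1, 1, 0, 0],
    ![0, 0, 0, 0, 0, 0],
    ![0, 0, 0, 0, 0, 0]]

def dft6c : Arr :=
  ![![0, 0, 0, 0, 0, 0],
    ![0, 0, 0, 0, 0, 0],
    ![0, 0, 0, 0, 0, 0],
    ![0, 0, 0, 0, 0, 0],
    ![-1, 1, 0, 0, 0, 0],
    ![-1, 1, 0, 0, 0, 0]]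

def ft2C (b : Arr) : Prop := b 0 1 > b 1 1
def et2C (b : Arr) : Prop := b 0 1 ≥ b 1 1
def ft3C1 (b : Arr) : Prop := b 0 2 > b 1 2 ∧ b 0 2 + b 1 1 > b 1 2 + b 2 1
def ft3C2 (b : Arr) : Prop := b 0 2 ≤ b 1 2 ∧ b 1 1 > b 2 1
def ft3C3 (b : Arr) : Prop := b 0 2 + b 1 1 ≤ b 1 2 + b 2 1 ∧ b 1 1 ≤ b 2 1
def et3C1 (b : Arr) : Prop := b 0 2 ≥ b 1 2 ∧ b 0 2 + b 1 1 ≥ b 1 2 + b 2 1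
def et3C2 (b : Arr) : Prop := b 0 2 < b 1 2 ∧ b 1 1 ≥ b 2 1
def et3C3 (b : Arr) : Prop := b 0 2 + b 1 1 < b 1 2 + b 2 1 ∧ b 1 1 < b 2 1
def ft4C1 (b : Arr) : Prop := b 0 3 > b 1 3 ∧ b 0 3 + b 1 2 > b 1 3 + b 2 2 ∧ b 0 3 + b 1 2 + b 2 1 > b 1 3 + b 2 2 + b 3 1
def ft4C2 (b : Arr) : Prop := b 0 3 ≤ b 1 3 ∧ b 1 2 > b 2 2 ∧ b 1 2 + b 2 1 > b 2 2 + b 3 1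
def ft4C3 (b : Arr) : Prop := b 0 3 + b 1 2 ≤ b 1 3 + b 2 2 ∧ b 1 2 ≤ b 2 2 ∧ b 2 1 > b 3 1
def ft4C4 (b : Arr) : Prop := b 0 3 + b 1 2 + b 2 1 ≤ b 1 3 + b 2 2 + b 3 1 ∧ b 1 2 + b 2 1 ≤ b 2 2 + b 3 1 ∧ b 2 1 ≤ b 3 1
def et4C1 (b : Arr) : Prop := b 0 3 ≥ b 1 3 ∧ b 0 3 + b 1 2 ≥ b 1 3 + b 2 2 ∧ b 0 3 + b 1 2 + b 2 1 ≥ b 1 3 + b 2 2 + b 3 1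
def et4C2 (b : Arr) : Prop := b 0 3 < b 1 3 ∧ b 1 2 ≥ b 2 2 ∧ b 1 2 + b 2 1 ≥ b 2 2 + b 3 1
def et4C3 (b : Arr) : Prop := b 0 3 + b 1 2 < b 1 3 + b 2 2 ∧ b 1 2 < b 2 2 ∧ b 2 1 ≥ b 3 1
def et4C4 (b : Arr) : Prop := b 0 3 + b 1 2 + b 2 1 < b 1 3 + b 2 2 + b 3 1 ∧ b 1 2 + b 2 1 < b 2 2 + b 3 1 ∧ b 2 1 < b 3 1
def ft5C (b : Arr) : Prop := b 1 3 + b 3 0 + b 3 1 > b 2 0 + b 2 1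
def et5C (b : Arr) : Prop := b 1 3 + b 3 0 + b 3 1 ≥ b 2 0 + b 2 1
def ft6C1 (b : Arr) : Prop := b 0 4 + b 2 0 + b 2 1 + b 2 2 > b 1 0 + b 1 1 + b 1 2 ∧ b 0 4 + b 2 0 + b 2 1 + 2 * b 2 2 + b 4 0 > b 1 0 + b 1 1 + b 1 2 + b 3 0
def ft6C2 (b : Arr) : Prop := b 0 4 + b 2 0 + b 2 1 + b 2 2 ≤ b 1 0 + b 1 1 + b 1 2 ∧ b 2 2 + b 4 0 > b 3 0
def ft6C3 (b : Arr) : Prop := b 0 4 + b 2 0 + b 2 1 + 2 * b 2 2 + b 4 0 ≤ b 1 0 + b 1 1 + b 1 2 + b 3 0 ∧ b 2 2 + b 4 0 ≤ b 3 0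
def et6C1 (b : Arr) : Prop := b 0 4 + b 2 0 + b 2 1 + b 2 2 ≥ b 1 0 + b 1 1 + b 1 2 ∧ b 0 4 + b 2 0 + b 2 1 + 2 * b 2 2 + b 4 0 ≥ b 1 0 + b 1 1 + b 1 2 + b 3 0
def et6C2 (b : Arr) : Prop := b 0 4 + b 2 0 + b 2 1 + b 2 2 < b 1 0 + b 1 1 + b 1 2 ∧ b 2 2 + b 4 0 ≥ b 3 0
def et6C3 (b : Arr) : Prop := b 0 4 + b 2 0 + b 2 1 + 2 * b 2 2 + b 4 0 < b 1 0 + b 1 1 + b 1 2 + b 3 0 ∧ b 2 2 + b 4 0 < b 3 0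

def ft1 (b : Arr) : Arr := b + dft1
def et1 (b : Arr) : Arr := b - dft1
def ft2 (b : Arr) : Arr := if b 0 1 > b 1 1 then b + dft2a else b + dft2b
def et2 (b : Arr) : Arr := if b 0 1 ≥ b 1 1 then b - dft2a else b - dft2b
def ft3 (b : Arr) : Arr :=
  if b 0 2 > b 1 2 ∧ b 0 2 + b 1 1 > b 1 2 + b 2 1 then b + dft3a
  else if b 0 2 ≤ b 1 2 ∧ b 1 1 > b 2 1 then b + dft3b
  else b + dft3c
def et3 (b : Arr) : Arr :=
  if b 0 2 ≥ b 1 2 ∧ b 0 2 + b 1 1 ≥ b 1 2 + b 2 1 then b - dft3a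
  else if b 0 2 < b 1 2 ∧ b 1 1 ≥ b 2 1 then b - dft3b
  else b - dft3c
def ft4 (b : Arr) : Arr :=
  if b 0 3 > b 1 3 ∧ b 0 3 + b 1 2 > b 1 3 + b 2 2 ∧ b 0 3 + b 1 2 + b 2 1 > b 1 3 + b 2 2 + b 3 1 then b + dft4a
  else if b 0 3 ≤ b 1 3 ∧ b 1 2 > b 2 2 ∧ b 1 2 + b 2 1 > b 2 2 + b 3 1 then b + dft4b
  else if b 0 3 + b 1 2 ≤ b 1 3 + b 2 2 ∧ b 1 2 ≤ b 2 2 ∧ b 2 1 > b 3 1 then b + dft4c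
  else b + dft4d
def et4 (b : Arr) : Arr :=
  if b 0 3 ≥ b 1 3 ∧ b 0 3 + b 1 2 ≥ b 1 3 + b 2 2 ∧ b 0 3 + b 1 2 + b 2 1 ≥ b 1 3 + b 2 2 + b 3 1 then b - dft4a
  else if b 0 3 < b 1 3 ∧ b 1 2 ≥ b 2 2 ∧ b 1 2 + b 2 1 ≥ b 2 2 + b 3 1 then b - dft4b
  else if b 0 3 + b 1 2 < b 1 3 + b 2 2 ∧ b 1 2 < b 2 2 ∧ b 2 1 ≥ b 3 1 then b - dft4c
  else b - dft4d
def ft5 (b : Arr) : Arr := if b 1 3 + b 3 0 + b 3 1 > b 2 0 + b 2 1 then b + dft5a else b + dft5b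
def et5 (b : Arr) : Arr := if b 1 3 + b 3 0 + b 3 1 ≥ b 2 0 + b 2 1 then b - dft5a else b - dft5b
def ft6 (b : Arr) : Arr :=
  if b 0 4 + b 2 0 + b 2 1 + b 2 2 > b 1 0 + b 1 1 + b 1 2 ∧ b 0 4 + b 2 0 + b 2 1 + 2 * b 2 2 + b 4 0 > b 1 0 + b 1 1 + b 1 2 + b 3 0 then b + dft6a
  else if b 0 4 + b 2 0 + b 2 1 + b 2 2 ≤ b 1 0 + b 1 1 + b 1 2 ∧ b 2 2 + b 4 0 > b 3 0 then b + dft6b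
  else b + dft6c
def et6 (b : Arr) : Arr :=
  if b 0 4 + b 2 0 + b 2 1 + b 2 2 ≥ b 1 0 + b 1 1 + b 1 2 ∧ b 0 4 + b 2 0 + b 2 1 + 2 * b 2 2 + b 4 0 ≥ b 1 0 + b 1 1 + b 1 2 + b 3 0 then b - dft6a
  else if b 0 4 + b 2 0 + b 2 1 + b 2 2 < b 1 0 + b 1 1 + b 1 2 ∧ b 2 2 + b 4 0 ≥ b 3 0 then b - dft6b
  else b - dft6c

/-- Subtracting `b0arr` preserves the linear forms whose sums are compared with zero in the case
conditions. -/
theorem sub_b0arr_forms {a0 a1 a2 a3 a4 a5 a6 : ℤ} {b c : Arr}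
    (hc : c = b - b0arr a0 a1 a2 a3 a4 a5 a6) :
    c 0 1 - c 1 1 = b 0 1 - b 1 1 ∧
    c 0 2 - c 1 2 = b 0 2 - b 1 2 ∧
    c 1 1 - c 2 1 = b 1 1 - b 2 1 ∧
    c 0 3 - c 1 3 = b 0 3 - b 1 3 ∧
    c 1 2 - c 2 2 = b 1 2 - b 2 2 ∧
    c 2 1 - c 3 1 = b 2 1 - b 3 1 ∧
    c 1 3 + c 3 0 + c 3 1 - (c 2 0 + c 2 1) = b 1 3 + b 3 0 + b 3 1 - (b 2 0 + b 2 1) ∧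
    c 0 4 + c 2 0 + c 2 1 + c 2 2 - (c 1 0 + c 1 1 + c 1 2) =
      b 0 4 + b 2 0 + b 2 1 + b 2 2 - (b 1 0 + b 1 1 + b 1 2) ∧
    c 2 2 + c 4 0 - c 3 0 = b 2 2 + b 4 0 - b 3 0 := by
  subst hc
  simp only [Pi.sub_apply, b0arr, Matrix.cons_val]
  refine ⟨?_, ?_, ?_, ?_, ?_, ?_, ?_, ?_, ?_⟩ <;> ring

theorem statement7 (a0 a1 a2 a3 a4 a5 a6 : ℤ)
    (h0 : 0 ≤ a0) (h1 : 0 ≤ a1) (h2 : 0 ≤ a2) (h3 : 0 ≤ a3) (h4 : 0 ≤ a4)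
    (h5 : 0 ≤ a5) (h6 : 0 ≤ a6)
    (b c : Arr) (hc : c = b - b0arr a0 a1 a2 a3 a4 a5 a6) :
    (ft2C c ↔ ft2C b) ∧
    (ft3C1 c ↔ ft3C1 b) ∧
    (ft3C2 c ↔ ft3C2 b) ∧
    (ft3C3 c ↔ ft3C3 b) ∧
    (ft4C1 c ↔ ft4C1 b) ∧
    (ft4C2 c ↔ ft4C2 b) ∧
    (ft4C3 c ↔ ft4C3 b) ∧
    (ft4C4 c ↔ ft4C4 b) ∧
    (ft5C c ↔ ft5C b) ∧
    (ft6C1 c ↔ ft6C1 b) ∧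
    (ft6C2 c ↔ ft6C2 b) ∧
    (ft6C3 c ↔ ft6C3 b) ∧
    (et2C c ↔ et2C b) ∧
    (et3C1 c ↔ et3C1 b) ∧
    (et3C2 c ↔ et3C2 b) ∧
    (et3C3 c ↔ et3C3 b) ∧
    (et4C1 c ↔ et4C1 b) ∧
    (et4C2 c ↔ et4C2 b) ∧
    (et4C3 c ↔ et4C3 b) ∧
    (et4C4 c ↔ et4C4 b) ∧
    (et5C c ↔ et5C b) ∧
    (et6C1 c ↔ et6C1 b) ∧
    (et6C2 c ↔ et6C2 b) ∧
    (et6C3 c ↔ et6C3 b) ∧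
    ft1 c = ft1 b - b0arr a0 a1 a2 a3 a4 a5 a6 ∧
    ft2 c = ft2 b - b0arr a0 a1 a2 a3 a4 a5 a6 ∧
    ft3 c = ft3 b - b0arr a0 a1 a2 a3 a4 a5 a6 ∧
    ft4 c = ft4 b - b0arr a0 a1 a2 a3 a4 a5 a6 ∧
    ft5 c = ft5 b - b0arr a0 a1 a2 a3 a4 a5 a6 ∧
    ft6 c = ft6 b - b0arr a0 a1 a2 a3 a4 a5 a6 ∧
    et1 c = et1 b - b0arr a0 a1 a2 a3 a4 a5 a6 ∧
    et2 c = et2 b - b0arr a0 a1 a2 a3 a4 a5 a6 ∧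
    et3 c = et3 b - b0arr a0 a1 a2 a3 a4 a5 a6 ∧
    et4 c = et4 b - b0arr a0 a1 a2 a3 a4 a5 a6 ∧
    et5 c = et5 b - b0arr a0 a1 a2 a3 a4 a5 a6 ∧
    et6 c = et6 b - b0arr a0 a1 a2 a3 a4 a5 a6 := by
  obtain ⟨e1, e2, e3, e4, e5, e6, e7, e8, e9⟩ := sub_b0arr_forms hc
  have add_comm_sub (d : Arr) : c + d = b + d - b0arr a0 a1 a2 a3 a4 a5 a6 := by
    rw [hc]; abel
  have sub_comm_sub (d : Arr) : c - d = b - d - b0arr a0 a1 a2 a3 a4 a5 a6 := by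
    rw [hc]; abel
  refine ⟨?_, ?_, ?_, ?_, ?_, ?_, ?_, ?_, ?_, ?_, ?_, ?_, ?_, ?_, ?_, ?_, ?_, ?_, ?_, ?_, ?_, ?_,
    ?_, ?_, add_comm_sub _, ?_, ?_, ?_, ?_, ?_, sub_comm_sub _, ?_, ?_, ?_, ?_, ?_⟩
  iterate 24
    · simp only [ft2C, ft3C1, ft3C2, ft3C3, ft4C1, ft4C2, ft4C3, ft4C4, ft5C, ft6C1, ft6C2, ft6C3,
        et2C, et3C1, et3C2, et3C3, et4C1, et4C2, et4C3, et4C4, et5C, et6C1, et6C2, et6C3]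
      omega
  all_goals
    simp only [ft2, ft3, ft4, ft5, ft6, et2, et3, et4, et5, et6]
    split_ifs <;> first | exact add_comm_sub _ | exact sub_comm_sub _ | (exfalso; omega)

end D6spin
end

section
/- For every b ∈ B^{6,∞} and every k ∈ {1,2,3,4,5,6}, the arrays f̃_k(b) and ẽ_k(b) again belong to B^{6,∞}. -/
namespace D6spin

theorem Binf.add {b c : Arr} (hb : Binf b) (hc : Binf c) : Binf (b + c) := by
  unfold Binf at *
  simp only [Pi.add_apply]
  omega

theorem Binf.sub {b c : Arr} (hb : Binf b) (hc : Binf c) : Binf (b - c) := by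
  unfold Binf at *
  simp only [Pi.sub_apply]
  omega

theorem binf_dft1 : Binf dft1 := by unfold Binf; decide

theorem binf_dft2a : Binf dft2a := by unfold Binf; decide

theorem binf_dft2b : Binf dft2b := by unfold Binf; decide

theorem binf_dft3a : Binf dft3a := by unfold Binf; decide

theorem binf_dft3b : Binf dft3b := by unfold Binf; decide

theorem binf_dft3c : Binf dft3c := by unfold Binf; decide

theorem binf_dft4a : Binf dft4a := by unfold Binf; decide

theorem binf_dft4b : Binf dft4b := by unfold Binf; decide

theorem binf_dft4c : Binf dft4c := by unfold Binf; decide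

theorem binf_dft4d : Binf dft4d := by unfold Binf; decide

theorem binf_dft5a : Binf dft5a := by unfold Binf; decide

theorem binf_dft5b : Binf dft5b := by unfold Binf; decide

theorem binf_dft6a : Binf dft6a := by unfold Binf; decide

theorem binf_dft6b : Binf dft6b := by unfold Binf; decide

theorem binf_dft6c : Binf dft6c := by unfold Binf; decide

theorem statement9 (b : Arr) (hb : Binf b) :
    Binf (ft1 b) ∧
    Binf (ft2 b) ∧
    Binf (ft3 b) ∧
    Binf (ft4 b) ∧
    Binf (ft5 b) ∧
    Binf (ft6 b) ∧
    Binf (et1 b) ∧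
    Binf (et2 b) ∧
    Binf (et3 b) ∧
    Binf (et4 b) ∧
    Binf (et5 b) ∧
    Binf (et6 b) := by
  refine ⟨?_, ?_, ?_, ?_, ?_, ?_, ?_, ?_, ?_, ?_, ?_, ?_⟩ <;>
    simp only [ft1, ft2, ft3, ft4, ft5, ft6, et1, et2, et3, et4, et5, et6] <;>
    (try split_ifs) <;>
    simp only [hb, Binf.add, Binf.sub,
      binf_dft1, binf_dft2a, binf_dft2b, binf_dft3a, binf_dft3b, binf_dft3c, binf_dft4a,
      binf_dft4b, binf_dft4c, binf_dft4d, binf_dft5a, binf_dft5b, binf_dft6a, binf_dft6b,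
      binf_dft6c]

end D6spin
end

section
/- For any integer array b = (b_{ij}) indexed by 1 ≤ i ≤ 6, i ≤ j ≤ i+5, and any k ∈ {1,2,3,4,5,6}: ẽ_k(f̃_k(b)) = b and f̃_k(ẽ_k(b)) = b. In particular the case conditions of f̃_3, f̃_4, f̃_6 (and of ẽ_3, ẽ_4, ẽ_6) are mutually exclusive and exhaustive, so these operators are well-defined total maps on integer arrays. -/
namespace D6spin

theorem et1_ft1 (b : Arr) : et1 (ft1 b) = b := by
  simp [et1, ft1]

theorem ft1_et1 (b : Arr) : ft1 (et1 b) = b := by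
  simp [ft1, et1]

theorem et2_ft2 (b : Arr) : et2 (ft2 b) = b := by
  unfold ft2
  split_ifs <;> unfold et2 <;> split_ifs <;>
    first
    | rw [add_sub_cancel_right]
    | exfalso
      simp [dft2a, dft2b] at *
      omega

theorem ft2_et2 (b : Arr) : ft2 (et2 b) = b := by
  unfold et2
  split_ifs <;> unfold ft2 <;> split_ifs <;>
    first
    | rw [sub_add_cancel]
    | exfalso
      simp [dft2a, dft2b] at *
      omega

theorem et3_ft3 (b : Arr) : et3 (ft3 b) = b := by
  unfold ft3
  split_ifs <;> unfold et3 <;> split_ifs <;>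
    first
    | rw [add_sub_cancel_right]
    | exfalso
      simp [dft3a, dft3b, dft3c] at *
      omega

theorem ft3_et3 (b : Arr) : ft3 (et3 b) = b := by
  unfold et3
  split_ifs <;> unfold ft3 <;> split_ifs <;>
    first
    | rw [sub_add_cancel]
    | exfalso
      simp [dft3a, dft3b, dft3c] at *
      omega

theorem et4_ft4 (b : Arr) : et4 (ft4 b) = b := by
  unfold ft4
  split_ifs <;> unfold et4 <;> split_ifs <;>
    first
    | rw [add_sub_cancel_right]
    | exfalso
      simp [dft4a, dft4b, dft4c, dft4d] at *
      omega

theorem ft4_et4 (b : Arr) : ft4 (et4 b) = b := by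
  unfold et4
  split_ifs <;> unfold ft4 <;> split_ifs <;>
    first
    | rw [sub_add_cancel]
    | exfalso
      simp [dft4a, dft4b, dft4c, dft4d] at *
      omega

theorem et5_ft5 (b : Arr) : et5 (ft5 b) = b := by
  unfold ft5
  split_ifs <;> unfold et5 <;> split_ifs <;>
    first
    | rw [add_sub_cancel_right]
    | exfalso
      simp [dft5a, dft5b] at *
      omega

theorem ft5_et5 (b : Arr) : ft5 (et5 b) = b := by
  unfold et5
  split_ifs <;> unfold ft5 <;> split_ifs <;>
    first
    | rw [sub_add_cancel]
    | exfalso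
      simp [dft5a, dft5b] at *
      omega

theorem et6_ft6 (b : Arr) : et6 (ft6 b) = b := by
  unfold ft6
  split_ifs <;> unfold et6 <;> split_ifs <;>
    first
    | rw [add_sub_cancel_right]
    | exfalso
      simp [dft6a, dft6b, dft6c] at *
      omega

theorem ft6_et6 (b : Arr) : ft6 (et6 b) = b := by
  unfold et6
  split_ifs <;> unfold ft6 <;> split_ifs <;>
    first
    | rw [sub_add_cancel]
    | exfalso
      simp [dft6a, dft6b, dft6c] at *
      omega

theorem statement10 (b : Arr) :
    (et1 (ft1 b) = b ∧ ft1 (et1 b) = b ∧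
    et2 (ft2 b) = b ∧ ft2 (et2 b) = b ∧
    et3 (ft3 b) = b ∧ ft3 (et3 b) = b ∧
    et4 (ft4 b) = b ∧ ft4 (et4 b) = b ∧
    et5 (ft5 b) = b ∧ ft5 (et5 b) = b ∧
    et6 (ft6 b) = b ∧ ft6 (et6 b) = b) ∧
    (ft3C1 b ∨ ft3C2 b ∨ ft3C3 b) ∧
    ¬(ft3C1 b ∧ ft3C2 b) ∧
    ¬(ft3C1 b ∧ ft3C3 b) ∧
    ¬(ft3C2 b ∧ ft3C3 b) ∧
    (ft4C1 b ∨ ft4C2 b ∨ ft4C3 b ∨ ft4C4 b) ∧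
    ¬(ft4C1 b ∧ ft4C2 b) ∧
    ¬(ft4C1 b ∧ ft4C3 b) ∧
    ¬(ft4C1 b ∧ ft4C4 b) ∧
    ¬(ft4C2 b ∧ ft4C3 b) ∧
    ¬(ft4C2 b ∧ ft4C4 b) ∧
    ¬(ft4C3 b ∧ ft4C4 b) ∧
    (ft6C1 b ∨ ft6C2 b ∨ ft6C3 b) ∧
    ¬(ft6C1 b ∧ ft6C2 b) ∧
    ¬(ft6C1 b ∧ ft6C3 b) ∧
    ¬(ft6C2 b ∧ ft6C3 b) ∧
    (et3C1 b ∨ et3C2 b ∨ et3C3 b) ∧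
    ¬(et3C1 b ∧ et3C2 b) ∧
    ¬(et3C1 b ∧ et3C3 b) ∧
    ¬(et3C2 b ∧ et3C3 b) ∧
    (et4C1 b ∨ et4C2 b ∨ et4C3 b ∨ et4C4 b) ∧
    ¬(et4C1 b ∧ et4C2 b) ∧
    ¬(et4C1 b ∧ et4C3 b) ∧
    ¬(et4C1 b ∧ et4C4 b) ∧
    ¬(et4C2 b ∧ et4C3 b) ∧
    ¬(et4C2 b ∧ et4C4 b) ∧
    ¬(et4C3 b ∧ et4C4 b) ∧
    (et6C1 b ∨ et6C2 b ∨ et6C3 b) ∧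
    ¬(et6C1 b ∧ et6C2 b) ∧
    ¬(et6C1 b ∧ et6C3 b) ∧
    ¬(et6C2 b ∧ et6C3 b) := by
  refine ⟨⟨et1_ft1 b, ft1_et1 b, et2_ft2 b, ft2_et2 b, et3_ft3 b, ft3_et3 b,
    et4_ft4 b, ft4_et4 b, et5_ft5 b, ft5_et5 b, et6_ft6 b, ft6_et6 b⟩, ?_⟩
  unfold ft3C1 ft3C2 ft3C3 ft4C1 ft4C2 ft4C3 ft4C4 ft6C1 ft6C2 ft6C3
    et3C1 et3C2 et3C3 et4C1 et4C2 et4C3 et4C4 et6C1 et6C2 et6C3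
  and_intros <;> omega

end D6spin
end

section
/- For every integer array b = (b_{ij}) indexed by 1 ≤ i ≤ 6, i ≤ j ≤ i+5 (in particular for every b ∈ B^{6,∞}), Ω(f̃_2(b)) = f̃_2^𝒳(Ω(b)): that is, b_{12} > b_{23} if and only if x_2^{(2)}+x_2^{(1)} > x_1^{(1)}+x_3^{(2)} where x = Ω(b), and applying f̃_2 to b then Ω gives the same 15-tuple as applying f̃_2^𝒳 to Ω(b). -/
namespace D6spin

def ft2X (x : Fin 15 → ℤ) : Fin 15 → ℤ :=
  if x 3 + x 11 > x 10 + x 6 then Function.update x 3 (x 3 - 1)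
  else Function.update x 11 (x 11 - 1)
def ft3X (x : Fin 15 → ℤ) : Fin 15 → ℤ :=
  if x 2 + x 6 > x 3 + x 5 ∧ x 2 + 2 * x 6 + x 12 > x 3 + x 11 + x 5 + x 8 then
    Function.update x 2 (x 2 - 1)
  else if x 2 + x 6 ≤ x 3 + x 5 ∧ x 6 + x 12 > x 11 + x 8 then
    Function.update x 6 (x 6 - 1)
  else Function.update x 12 (x 12 - 1)
def ft4X (x : Fin 15 → ℤ) : Fin 15 → ℤ :=
  if x 1 + x 5 > x 2 + x 4 ∧ x 1 + 2 * x 5 + x 8 > x 2 + x 6 + x 4 + x 7 ∧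
      x 1 + 2 * x 5 + 2 * x 8 + x 13 > x 2 + x 6 + x 12 + x 4 + x 9 + x 7 then
    Function.update x 1 (x 1 - 1)
  else if x 1 + x 5 ≤ x 2 + x 4 ∧ x 5 + x 8 > x 6 + x 7 ∧
      x 5 + 2 * x 8 + x 13 > x 6 + x 12 + x 9 + x 7 then
    Function.update x 5 (x 5 - 1)
  else if x 1 + 2 * x 5 + x 8 ≤ x 2 + x 6 + x 4 + x 7 ∧ x 5 + x 8 ≤ x 6 + x 7 ∧
      x 8 + x 13 > x 12 + x 9 then
    Function.update x 8 (x 8 - 1)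
  else Function.update x 13 (x 13 - 1)
def ft5X (x : Fin 15 → ℤ) : Fin 15 → ℤ :=
  if x 4 + x 9 > x 5 + x 8 then Function.update x 4 (x 4 - 1)
  else Function.update x 9 (x 9 - 1)
def ft6X (x : Fin 15 → ℤ) : Fin 15 → ℤ :=
  if x 0 + x 7 > x 1 + x 5 ∧ x 0 + 2 * x 7 + x 14 > x 1 + x 5 + x 8 + x 13 then
    Function.update x 0 (x 0 - 1)
  else if x 0 + x 7 ≤ x 1 + x 5 ∧ x 7 + x 14 > x 8 + x 13 then
    Function.update x 7 (x 7 - 1)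
  else Function.update x 14 (x 14 - 1)

theorem statement11 (b : Arr) :
    (b 0 1 > b 1 1 ↔ Omega b 3 + Omega b 11 > Omega b 10 + Omega b 6) ∧
    Omega (ft2 b) = ft2X (Omega b) := by
  have hcond : b 0 1 > b 1 1 ↔ Omega b 3 + Omega b 11 > Omega b 10 + Omega b 6 := by
    change b 0 1 > b 1 1 ↔ b 0 0 + b 0 1 + b 1 0 > b 0 0 + (b 1 0 + b 1 1)
    omega
  refine ⟨hcond, ?_⟩
  unfold ft2 ft2X
  simp only [← hcond]
  split_ifs <;>
  · ext i
    fin_cases i <;> simp [Omega, dft2a, dft2b, Function.update] <;> ring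

end D6spin
end

section
/- For every integer array b = (b_{ij}) indexed by 1 ≤ i ≤ 6, i ≤ j ≤ i+5 (in particular for every b ∈ B^{6,∞}), Ω(f̃_3(b)) = f̃_3^𝒳(Ω(b)): the three case conditions of f̃_3 on b are equivalent respectively to the three case conditions of f̃_3^𝒳 on x = Ω(b), and the resulting 15-tuples agree. -/
namespace D6spin

theorem Omega_add (b c : Arr) : Omega (b + c) = Omega b + Omega c := by
  funext k
  fin_cases k <;> simp [Omega] <;> ring

theorem update_sub_one_eq_add_single (x : Fin 15 → ℤ) (k : Fin 15) :
    Function.update x k (x k - 1) = x + Pi.single k (-1) := by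
  funext l
  by_cases h : l = k
  · subst h
    simp [sub_eq_add_neg]
  · simp [h]

theorem Omega_dft3a : Omega dft3a = Pi.single 2 (-1) := by decide

theorem Omega_dft3b : Omega dft3b = Pi.single 6 (-1) := by decide

theorem Omega_dft3c : Omega dft3c = Pi.single 12 (-1) := by decide

theorem statement12 (b : Arr) :
    ((b 0 2 > b 1 2 ∧ b 0 2 + b 1 1 > b 1 2 + b 2 1) ↔
      (Omega b 2 + Omega b 6 > Omega b 3 + Omega b 5 ∧
        Omega b 2 + 2 * Omega b 6 + Omega b 12 >
          Omega b 3 + Omega b 11 + Omega b 5 + Omega b 8)) ∧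
    ((b 0 2 ≤ b 1 2 ∧ b 1 1 > b 2 1) ↔
      (Omega b 2 + Omega b 6 ≤ Omega b 3 + Omega b 5 ∧
        Omega b 6 + Omega b 12 > Omega b 11 + Omega b 8)) ∧
    ((b 0 2 + b 1 1 ≤ b 1 2 + b 2 1 ∧ b 1 1 ≤ b 2 1) ↔
      (Omega b 6 + Omega b 12 ≤ Omega b 11 + Omega b 8 ∧
        Omega b 2 + 2 * Omega b 6 + Omega b 12 ≤
          Omega b 3 + Omega b 11 + Omega b 5 + Omega b 8)) ∧
    Omega (ft3 b) = ft3X (Omega b) := by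
  have h₁ : (b 0 2 > b 1 2 ∧ b 0 2 + b 1 1 > b 1 2 + b 2 1) ↔
      (Omega b 2 + Omega b 6 > Omega b 3 + Omega b 5 ∧
        Omega b 2 + 2 * Omega b 6 + Omega b 12 >
          Omega b 3 + Omega b 11 + Omega b 5 + Omega b 8) := by
    simp only [Omega, Matrix.cons_val]
    omega
  have h₂ : (b 0 2 ≤ b 1 2 ∧ b 1 1 > b 2 1) ↔
      (Omega b 2 + Omega b 6 ≤ Omega b 3 + Omega b 5 ∧
        Omega b 6 + Omega b 12 > Omega b 11 + Omega b 8) := by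
    simp only [Omega, Matrix.cons_val]
    omega
  refine ⟨h₁, h₂, ?_, ?_⟩
  · simp only [Omega, Matrix.cons_val]
    omega
  · simp only [ft3, ft3X, ← h₁, ← h₂, update_sub_one_eq_add_single]
    split_ifs
    · rw [Omega_add, Omega_dft3a]
    · rw [Omega_add, Omega_dft3b]
    · rw [Omega_add, Omega_dft3c]

end D6spin
end

section
/- For every integer array b = (b_{ij}) indexed by 1 ≤ i ≤ 6, i ≤ j ≤ i+5 (in particular for every b ∈ B^{6,∞}), Ω(f̃_4(b)) = f̃_4^𝒳(Ω(b)): the four case conditions of f̃_4 on b are equivalent respectively to the four case conditions of f̃_4^𝒳 on x = Ω(b), and the resulting 15-tuples agree. -/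
namespace D6spin

theorem Omega_add_dft4a (b : Arr) :
    Omega (b + dft4a) = Function.update (Omega b) 1 (Omega b 1 - 1) := by
  funext i
  fin_cases i <;> simp [Omega, dft4a, Function.update] <;> ring

theorem Omega_add_dft4b (b : Arr) :
    Omega (b + dft4b) = Function.update (Omega b) 5 (Omega b 5 - 1) := by
  funext i
  fin_cases i <;> simp [Omega, dft4b, Function.update] <;> ring

theorem Omega_add_dft4c (b : Arr) :
    Omega (b + dft4c) = Function.update (Omega b) 8 (Omega b 8 - 1) := by
  funext i
  fin_cases i <;> simp [Omega, dft4c, Function.update] <;> ring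

theorem Omega_add_dft4d (b : Arr) :
    Omega (b + dft4d) = Function.update (Omega b) 13 (Omega b 13 - 1) := by
  funext i
  fin_cases i <;> simp [Omega, dft4d, Function.update] <;> ring

theorem statement13 (b : Arr) :
    ((b 0 3 > b 1 3 ∧ b 0 3 + b 1 2 > b 1 3 + b 2 2 ∧ b 0 3 + b 1 2 + b 2 1 > b 1 3 + b 2 2 + b 3 1) ↔
      (Omega b 1 + Omega b 5 > Omega b 2 + Omega b 4 ∧
        Omega b 1 + 2 * Omega b 5 + Omega b 8 >
          Omega b 2 + Omega b 6 + Omega b 4 + Omega b 7 ∧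
        Omega b 1 + 2 * Omega b 5 + 2 * Omega b 8 + Omega b 13 >
          Omega b 2 + Omega b 6 + Omega b 12 + Omega b 4 + Omega b 9 + Omega b 7)) ∧
    ((b 0 3 ≤ b 1 3 ∧ b 1 2 > b 2 2 ∧ b 1 2 + b 2 1 > b 2 2 + b 3 1) ↔
      (Omega b 1 + Omega b 5 ≤ Omega b 2 + Omega b 4 ∧
        Omega b 5 + Omega b 8 > Omega b 6 + Omega b 7 ∧
        Omega b 5 + 2 * Omega b 8 + Omega b 13 >
          Omega b 6 + Omega b 12 + Omega b 9 + Omega b 7)) ∧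
    ((b 0 3 + b 1 2 ≤ b 1 3 + b 2 2 ∧ b 1 2 ≤ b 2 2 ∧ b 2 1 > b 3 1) ↔
      (Omega b 1 + 2 * Omega b 5 + Omega b 8 ≤
          Omega b 2 + Omega b 6 + Omega b 4 + Omega b 7 ∧
        Omega b 5 + Omega b 8 ≤ Omega b 6 + Omega b 7 ∧
        Omega b 8 + Omega b 13 > Omega b 12 + Omega b 9)) ∧
    ((b 0 3 + b 1 2 + b 2 1 ≤ b 1 3 + b 2 2 + b 3 1 ∧ b 1 2 + b 2 1 ≤ b 2 2 + b 3 1 ∧ b 2 1 ≤ b 3 1) ↔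
      (Omega b 8 + Omega b 13 ≤ Omega b 12 + Omega b 9 ∧
        Omega b 5 + 2 * Omega b 8 + Omega b 13 ≤
          Omega b 6 + Omega b 12 + Omega b 9 + Omega b 7 ∧
        Omega b 1 + 2 * Omega b 5 + 2 * Omega b 8 + Omega b 13 ≤
          Omega b 2 + Omega b 6 + Omega b 12 + Omega b 4 + Omega b 9 + Omega b 7)) ∧
    Omega (ft4 b) = ft4X (Omega b) := by
  have ha : Omega b 1 + Omega b 5 - (Omega b 2 + Omega b 4) = b 0 3 - b 1 3 := by
    simp only [Omega, Matrix.cons_val]; ring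
  have hb : Omega b 5 + Omega b 8 - (Omega b 6 + Omega b 7) = b 1 2 - b 2 2 := by
    simp only [Omega, Matrix.cons_val]; ring
  have hc : Omega b 8 + Omega b 13 - (Omega b 12 + Omega b 9) = b 2 1 - b 3 1 := by
    simp only [Omega, Matrix.cons_val]; ring
  refine (fun h₁ h₂ h₃ h₄ => ⟨h₁, h₂, h₃, h₄, ?_⟩) ?_ ?_ ?_ ?_
  iterate 4 omega
  unfold ft4 ft4X
  simp only [h₁, h₂, h₃]
  split_ifs
  · exact Omega_add_dft4a b
  · exact Omega_add_dft4b b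
  · exact Omega_add_dft4c b
  · exact Omega_add_dft4d b

end D6spin
end

section
/- For every integer array b = (b_{ij}) indexed by 1 ≤ i ≤ 6, i ≤ j ≤ i+5 (in particular for every b ∈ B^{6,∞}), Ω(f̃_6(b)) = f̃_6^𝒳(Ω(b)): the three case conditions of f̃_6 on b are equivalent respectively to the three case conditions of f̃_6^𝒳 on x = Ω(b), and the resulting 15-tuples agree. -/
namespace D6spin

theorem Omega_add_dft6a (b : Arr) :
    Omega (b + dft6a) = Function.update (Omega b) 0 (Omega b 0 - 1) := by
  ext i
  fin_cases i <;> simp [Omega, dft6a, Function.update]; ring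

theorem Omega_add_dft6b (b : Arr) :
    Omega (b + dft6b) = Function.update (Omega b) 7 (Omega b 7 - 1) := by
  ext i
  fin_cases i <;> simp [Omega, dft6b, Function.update]; ring

theorem Omega_add_dft6c (b : Arr) :
    Omega (b + dft6c) = Function.update (Omega b) 14 (Omega b 14 - 1) := by
  ext i
  fin_cases i <;> simp [Omega, dft6c, Function.update]; ring

theorem statement15 (b : Arr) :
    ((b 0 4 + b 2 0 + b 2 1 + b 2 2 > b 1 0 + b 1 1 + b 1 2 ∧ b 0 4 + b 2 0 + b 2 1 + 2 * b 2 2 + b 4 0 > b 1 0 + b 1 1 + b 1 2 + b 3 0) ↔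
      (Omega b 0 + Omega b 7 > Omega b 1 + Omega b 5 ∧
        Omega b 0 + 2 * Omega b 7 + Omega b 14 >
          Omega b 1 + Omega b 5 + Omega b 8 + Omega b 13)) ∧
    ((b 0 4 + b 2 0 + b 2 1 + b 2 2 ≤ b 1 0 + b 1 1 + b 1 2 ∧ b 2 2 + b 4 0 > b 3 0) ↔
      (Omega b 0 + Omega b 7 ≤ Omega b 1 + Omega b 5 ∧
        Omega b 7 + Omega b 14 > Omega b 8 + Omega b 13)) ∧
    ((b 0 4 + b 2 0 + b 2 1 + 2 * b 2 2 + b 4 0 ≤ b 1 0 + b 1 1 + b 1 2 + b 3 0 ∧ b 2 2 + b 4 0 ≤ b 3 0) ↔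
      (Omega b 7 + Omega b 14 ≤ Omega b 8 + Omega b 13 ∧
        Omega b 0 + 2 * Omega b 7 + Omega b 14 ≤
          Omega b 1 + Omega b 5 + Omega b 8 + Omega b 13)) ∧
    Omega (ft6 b) = ft6X (Omega b) := by
  have h0 : Omega b 0 = b 0 0 + b 0 1 + b 0 2 + b 0 3 + b 0 4 := rfl
  have h1 : Omega b 1 = b 0 0 + b 0 1 + b 0 2 + b 0 3 := rfl
  have h5 : Omega b 5 = b 1 0 + b 1 1 + b 1 2 := rfl
  have h7 : Omega b 7 = b 2 0 + b 2 1 + b 2 2 := rfl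
  have h8 : Omega b 8 = b 2 0 + b 2 1 := rfl
  have h13 : Omega b 13 = b 3 0 := rfl
  have h14 : Omega b 14 = b 4 0 := rfl
  refine ⟨by omega, by omega, by omega, ?_⟩
  unfold ft6 ft6X
  rw [apply_ite Omega, apply_ite Omega, Omega_add_dft6a, Omega_add_dft6b, Omega_add_dft6c]
  exact if_congr (by omega) rfl (if_congr (by omega) rfl rfl)

end D6spin
end
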